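/- Let R^5 be the profile ≽_1: a,{b,c,d}; ≽_2: {b,d},a,c; ≽_3: a,{b,c,d}; ≽_4: {b,c},a,d, and let R^6 be obtained from R^5 by replacing agent 2's preference with ≽_2: b,{a,c,d}. Then f(R^6)(c) = f(R^6)(d) = 0, and if f(R^5)(a) > 1/2 then f(R^6)(a) > 1/2. -/

import Mathlib

open Finset
open scoped Classical

section Framework

variable {A : Type*} [Fintype A] {n : ℕ}

/-- `p` is a lottery (probability distribution) on the set of alternatives `A`. -/
def IsLottery (p : A → ℝ) : Prop := (∀ x, 0 ≤ p x) ∧ ∑ x, p x = 1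

/-- `r` is a weak preference relation: complete (total) and transitive. -/
def IsPref (r : A → A → Prop) : Prop := Total r ∧ Transitive r

/-- A preference profile assigns a weak preference relation to each of the `n` agents. -/
def IsProfile (R : Fin n → A → A → Prop) : Prop := ∀ i, IsPref (R i)

/-- The probability that `p` assigns to alternatives weakly preferred (by `r`) to `x`. -/
noncomputable def upperProb (r : A → A → Prop) (p : A → ℝ) (x : A) : ℝ :=
  ∑ y ∈ univ.filter (fun y => r y x), p y

/-- Stochastic dominance: `p ≽^sd q` w.r.t. the preference relation `r`. -/
def SDge (r : A → A → Prop) (p q : A → ℝ) : Prop :=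
  ∀ x, upperProb r q x ≤ upperProb r p x

/-- Strict stochastic dominance: `p ≻^sd q` w.r.t. the preference relation `r`. -/
def SDgt (r : A → A → Prop) (p q : A → ℝ) : Prop :=
  SDge r p q ∧ ¬ SDge r q p

/-- A social decision scheme maps every preference profile to a lottery. -/
def IsSDS (f : (Fin n → A → A → Prop) → (A → ℝ)) : Prop :=
  ∀ R : Fin n → A → A → Prop, IsProfile R → IsLottery (f R)

/-- Anonymity: invariance under permutations of the agents. -/
def Anonymous (f : (Fin n → A → A → Prop) → (A → ℝ)) : Prop :=
  ∀ R : Fin n → A → A → Prop, IsProfile R → ∀ π : Equiv.Perm (Fin n),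
    f (fun i => R (π i)) = f R

/-- Neutrality: `f(R^σ)(σ x) = f(R)(x)`, where `R^σ` relabels alternatives by `σ`
(i.e. `σ x ≽^σ_i σ y ↔ x ≽_i y`). -/
def Neutral (f : (Fin n → A → A → Prop) → (A → ℝ)) : Prop :=
  ∀ R : Fin n → A → A → Prop, IsProfile R → ∀ σ : Equiv.Perm A, ∀ x : A,
    f (fun i u v => R i (σ.symm u) (σ.symm v)) (σ x) = f R x

/-- The lottery `p` is sd-efficient for the profile `R`: no lottery `q` is weakly
sd-preferred to `p` by all agents and strictly sd-preferred by some agent. -/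
def SDEfficientLottery (R : Fin n → A → A → Prop) (p : A → ℝ) : Prop :=
  ¬ ∃ q : A → ℝ, IsLottery q ∧ (∀ i, SDge (R i) q p) ∧ (∃ i, SDgt (R i) q p)

/-- sd-efficiency of a social decision scheme. -/
def SDEfficient (f : (Fin n → A → A → Prop) → (A → ℝ)) : Prop :=
  ∀ R : Fin n → A → A → Prop, IsProfile R → SDEfficientLottery R (f R)

/-- sd-strategyproofness: no agent can misreport and obtain a strictly
sd-preferred lottery. -/
def SDStrategyproof (f : (Fin n → A → A → Prop) → (A → ℝ)) : Prop :=
  ∀ R R' : Fin n → A → A → Prop, IsProfile R → IsProfile R' → ∀ i : Fin n,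
    (∀ j, j ≠ i → R j = R' j) → ¬ SDgt (R i) (f R') (f R)

/-- `x` is the unique most-preferred alternative of the relation `r`. -/
def UniqueTop (r : A → A → Prop) (x : A) : Prop :=
  ∀ y, y ≠ x → r x y ∧ ¬ r y x

/-- `f` extends random dictatorship: whenever every agent has a unique top choice,
each alternative gets probability (number of agents having it as top)/n. -/
def ExtendsRD (f : (Fin n → A → A → Prop) → (A → ℝ)) : Prop :=
  ∀ R : Fin n → A → A → Prop, IsProfile R →
    ∀ t : Fin n → A, (∀ i, UniqueTop (R i) (t i)) →
      ∀ x : A, f R x = ((univ.filter (fun i => t i = x)).card : ℝ) / (n : ℝ)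

/-- `x` is Pareto-dominated in the profile `R`. -/
def Pareto_Dominated (R : Fin n → A → A → Prop) (x : A) : Prop :=
  ∃ y : A, (∀ i, R i y x) ∧ ∃ i, R i y x ∧ ¬ R i x y

end Framework

/-! Concrete setting: alternatives `A = {a,b,c,d}` encoded as `Fin 4`. -/

/-- The alternative `a`. -/ def a : Fin 4 := 0
/-- The alternative `b`. -/ def b : Fin 4 := 1
/-- The alternative `c`. -/ def c : Fin 4 := 2
/-- The alternative `d`. -/ def d : Fin 4 := 3

/-- The weak preference relation induced by a rank function over `(a,b,c,d)`
(lower rank = more preferred; equal ranks = indifference). -/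
def pr (rk : Fin 4 → ℕ) : Fin 4 → Fin 4 → Prop := fun x y => rk x ≤ rk y


/-- The profile `R5`: ≽₁: a,{b,c,d}; ≽₂: {b,d},a,c; ≽₃: a,{b,c,d}; ≽₄: {b,c},a,d. -/
def R5 : Fin 4 → Fin 4 → Fin 4 → Prop :=
  ![pr ![0,1,1,1], pr ![1,0,2,0], pr ![0,1,1,1], pr ![1,0,0,2]]

/-- The profile `R6`: ≽₁: a,{b,c,d}; ≽₂: b,{a,c,d}; ≽₃: a,{b,c,d}; ≽₄: {b,c},a,d. -/
def R6 : Fin 4 → Fin 4 → Fin 4 → Prop :=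
  ![pr ![0,1,1,1], pr ![1,0,1,1], pr ![0,1,1,1], pr ![1,0,0,2]]

section ParetoEfficiency

variable {A : Type*} [Fintype A]

theorem upperProb_eq_sum_ite (r : A → A → Prop) (p : A → ℝ) (w : A) :
    upperProb r p w = ∑ z, if r z w then p z else 0 := by
  unfold upperProb
  rw [Finset.sum_filter]

/-- The effect on upper probabilities of moving the mass of `x` to `y`. -/
theorem upperProb_transfer (r : A → A → Prop) (p : A → ℝ) (x y w : A) :
    upperProb r (fun z => p z + (if z = y then p x else 0) - (if z = x then p x else 0)) w =
      upperProb r p w + (if r y w then p x else 0) - (if r x w then p x else 0) := by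
  have split (z : A) :
      (if r z w then p z + (if z = y then p x else 0) - (if z = x then p x else 0) else 0) =
        (if r z w then p z else 0) + (if z = y then (if r y w then p x else 0) else 0) -
          (if z = x then (if r x w then p x else 0) else 0) := by
    split_ifs <;> simp_all
  simp only [upperProb_eq_sum_ite, split, Finset.sum_sub_distrib, Finset.sum_add_distrib,
    Finset.sum_ite_eq', Finset.mem_univ, if_true]

/-- An sd-efficient lottery puts no mass on Pareto-dominated alternatives. -/
theorem SDEfficientLottery.apply_eq_zero {n : ℕ} {R : Fin n → A → A → Prop} {p : A → ℝ} {x : A}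
    (hR : IsProfile R) (heff : SDEfficientLottery R p) (hp : IsLottery p)
    (hx : Pareto_Dominated R x) : p x = 0 := by
  obtain ⟨y, hyx, i, -, hxy⟩ := hx
  by_contra hpx
  have hpos : 0 < p x := lt_of_le_of_ne (hp.1 x) (Ne.symm hpx)
  have hne : y ≠ x := by
    rintro rfl
    exact hxy (hyx i)
  have weak (j : Fin n) : SDge (R j)
      (fun z => p z + (if z = y then p x else 0) - (if z = x then p x else 0)) p := by
    intro w
    rw [upperProb_transfer]
    by_cases hxw : R j x w
    · simp [hxw, (hR j).2 (hyx j) hxw]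
    · simp only [hxw, if_false]
      split_ifs <;> linarith
  refine heff ⟨_, ⟨fun z => ?_, ?_⟩, weak, i, weak i, fun hge => ?_⟩
  · have := hp.1 z
    rcases eq_or_ne z x with rfl | hz
    · simp [hne.symm]
    · simp only [hz, if_false]
      split_ifs <;> linarith
  · simp [Finset.sum_sub_distrib, Finset.sum_add_distrib, hp.2]
  · have hyy : R i y y := ((hR i).1 y y).elim id id
    have := hge y
    rw [upperProb_transfer] at this
    simp only [hyy, hxy, if_true, if_false] at this
    linarith

/-- Among lotteries supported on `{x, y}`, an agent strictly preferring `x` to `y` strictly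
prefers more mass on `x`. -/
theorem sdGt_of_support_pair {r : A → A → Prop} (hr : IsPref r) {p q : A → ℝ} {x y : A}
    (hp : IsLottery p) (hq : IsLottery q) (hp0 : ∀ z, z ≠ x → z ≠ y → p z = 0)
    (hq0 : ∀ z, z ≠ x → z ≠ y → q z = 0) (hxy : r x y) (hyx : ¬ r y x) (hlt : q x < p x) :
    SDgt r p q := by
  have hne : x ≠ y := by
    rintro rfl
    exact hyx hxy
  have upper {s : A → ℝ} (hs : ∀ z, z ≠ x → z ≠ y → s z = 0) (w : A) :
      upperProb r s w = (if r x w then s x else 0) + (if r y w then s y else 0) := by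
    rw [upperProb_eq_sum_ite]
    exact Fintype.sum_eq_add x y hne fun z hz => by simp [hs z hz.1 hz.2]
  have total {s : A → ℝ} (hl : IsLottery s) (hs : ∀ z, z ≠ x → z ≠ y → s z = 0) :
      s x + s y = 1 := by
    rw [← hl.2]
    exact (Fintype.sum_eq_add x y hne fun z hz => hs z hz.1 hz.2).symm
  have hp1 := total hp hp0
  have hq1 := total hq hq0
  constructor
  · intro w
    rw [upper hp0, upper hq0]
    by_cases hyw : r y w
    · simp [hyw, hr.2 hxy hyw, hp1, hq1]
    · simp only [hyw, if_false]
      split_ifs <;> linarith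
  · intro hge
    have hxx : r x x := (hr.1 x x).elim id id
    have := hge x
    rw [upper hp0, upper hq0] at this
    simp only [hxx, hyx, if_true, if_false] at this
    linarith

end ParetoEfficiency

theorem isPref_pr (rk : Fin 4 → ℕ) : IsPref (pr rk) :=
  ⟨fun x y => le_total (rk x) (rk y), fun _ _ _ => le_trans⟩

theorem isProfile_R5 : IsProfile R5 := by
  intro i
  fin_cases i <;> exact isPref_pr _

theorem isProfile_R6 : IsProfile R6 := by
  intro i
  fin_cases i <;> exact isPref_pr _

theorem pareto_dominated_R5_c : Pareto_Dominated R5 c :=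
  ⟨b, by simp [Fin.forall_fin_succ, R5, pr, b, c], 1, by simp [R5, pr, b, c]⟩

theorem pareto_dominated_R5_d : Pareto_Dominated R5 d :=
  ⟨b, by simp [Fin.forall_fin_succ, R5, pr, b, d], 3, by simp [R5, pr, b, d]⟩

theorem pareto_dominated_R6_c : Pareto_Dominated R6 c :=
  ⟨b, by simp [Fin.forall_fin_succ, R6, pr, b, c], 1, by simp [R6, pr, b, c]⟩

theorem pareto_dominated_R6_d : Pareto_Dominated R6 d :=
  ⟨b, by simp [Fin.forall_fin_succ, R6, pr, b, d], 1, by simp [R6, pr, b, d]⟩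

theorem stmt9 (f : (Fin 4 → Fin 4 → Fin 4 → Prop) → (Fin 4 → ℝ))
    (hf : IsSDS f) (han : Anonymous f) (hneu : Neutral f)
    (heff : SDEfficient f) (hsp : SDStrategyproof f) :
    f R6 c = 0 ∧ f R6 d = 0 ∧ (f R5 a > 1/2 → f R6 a > 1/2) := by
  have h5 := hf R5 isProfile_R5
  have h6 := hf R6 isProfile_R6
  have e5 := heff R5 isProfile_R5
  have e6 := heff R6 isProfile_R6
  have c5 := e5.apply_eq_zero isProfile_R5 h5 pareto_dominated_R5_c
  have d5 := e5.apply_eq_zero isProfile_R5 h5 pareto_dominated_R5_d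
  have c6 := e6.apply_eq_zero isProfile_R6 h6 pareto_dominated_R6_c
  have d6 := e6.apply_eq_zero isProfile_R6 h6 pareto_dominated_R6_d
  refine ⟨c6, d6, fun hgt => ?_⟩
  have support {p : Fin 4 → ℝ} (hc : p c = 0) (hd : p d = 0) (z : Fin 4) (hb : z ≠ b)
      (ha : z ≠ a) : p z = 0 := by
    fin_cases z
    exacts [absurd rfl ha, absurd rfl hb, hc, hd]
  have hle : f R6 b ≤ f R5 b := by
    by_contra! hlt
    refine hsp R5 R6 isProfile_R5 isProfile_R6 1 (fun j hj => ?_)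
      (sdGt_of_support_pair (isProfile_R5 1) h6 h5 (support c6 d6) (support c5 d5) ?_ ?_ hlt)
    · fin_cases j <;> first | rfl | exact absurd rfl hj
    · simp [R5, pr, a, b]
    · simp [R5, pr, a, b]
  have s5 : f R5 a + f R5 b + f R5 c + f R5 d = 1 := (Fin.sum_univ_four _).symm.trans h5.2
  have s6 : f R6 a + f R6 b + f R6 c + f R6 d = 1 := (Fin.sum_univ_four _).symm.trans h6.2
  linarith
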